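/- Let G be a finite group. For independent uniformly random g, h ∈ G, the expected number of tuples realizing a given element: for every z ∈ G, the number of pairs (g,h) ∈ G × G with [g,h] = z equals |G| · Σ_{ψ ∈ Irr(G)} ψ(z)/ψ(1), where the sum is over irreducible complex characters of G and [g,h] = ghg⁻¹h⁻¹. -/

import Mathlib

/-- `χ : G → ℂ` is an irreducible (complex) character of `G`: it is the character of some
simple (irreducible) finite-dimensional complex representation of `G`. -/
def IsIrredChar (G : Type) [Group G] (χ : G → ℂ) : Prop :=
  ∃ V : FDRep ℂ G, CategoryTheory.Simple V ∧ ∀ x : G, V.character x = χ x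

open Module in
lemma aux_schur {G : Type} [Group G] [Fintype G] (V : FDRep ℂ G) [CategoryTheory.Simple V]
    (f : V →ₗ[ℂ] V) (hf : ∀ g, V.ρ g ∘ₗ f = f ∘ₗ V.ρ g) :
    V.character 1 • f = LinearMap.trace ℂ V f • LinearMap.id := by
  have h1 : finrank ℂ (Representation.linHom V.ρ V.ρ).invariants = 1 := by
    rw [(Representation.linHom.invariantsEquivFDRepHom V V).finrank_eq]
    exact CategoryTheory.finrank_endomorphism_simple_eq_one ℂ V
  have hmem : ∀ f : V →ₗ[ℂ] V, (∀ g, V.ρ g ∘ₗ f = f ∘ₗ V.ρ g) →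
      f ∈ (Representation.linHom V.ρ V.ρ).invariants := by
    intro f hf
    rw [Representation.mem_invariants]
    intro g
    rw [Representation.linHom_apply, ← LinearMap.comp_assoc, hf, LinearMap.comp_assoc]
    rw [← Module.End.mul_eq_comp (V.ρ g), ← map_mul]
    simp
    rfl
  have hid := hmem LinearMap.id (fun g => by simp)
  have hne : (⟨_, hid⟩ : (Representation.linHom V.ρ V.ρ).invariants) ≠ 0 := by
    intro h0
    have h0' : (LinearMap.id : V →ₗ[ℂ] V) = 0 := congrArg Subtype.val h0
    have : Subsingleton (Representation.linHom V.ρ V.ρ).invariants := by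
      refine ⟨fun a b => Subtype.ext (LinearMap.ext fun x => ?_)⟩
      have hx : x = 0 := LinearMap.congr_fun h0' x
      rw [hx, map_zero, map_zero]
    rw [finrank_zero_of_subsingleton] at h1
    exact zero_ne_one h1
  obtain ⟨c, hc⟩ := (finrank_eq_one_iff_of_nonzero' _ hne).mp h1 ⟨f, hmem f hf⟩
  have hc' : c • (LinearMap.id : V →ₗ[ℂ] V) = f := congrArg Subtype.val hc
  rw [← hc', FDRep.char_one, map_smul, LinearMap.trace_id, smul_smul, smul_eq_mul, mul_comm]

lemma aux_char_one_ne {G : Type} [Group G] [Fintype G] (V : FDRep ℂ G)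
    [hV : CategoryTheory.Simple V] : V.character 1 ≠ 0 := by
  intro h
  rw [FDRep.char_one] at h
  have h0 : Module.finrank ℂ V = 0 := by exact_mod_cast h
  have : Subsingleton V := Module.finrank_zero_iff.mp h0
  have hz : ∀ g, V.character g = 0 := by
    intro g
    unfold FDRep.character
    rw [Subsingleton.elim (V.ρ g) 0, map_zero]
  have := (FDRep.simple_iff_char_is_norm_one V).mp hV
  simp only [hz, mul_zero, Finset.sum_const_zero] at this
  exact NeZero.ne (Nat.card G : ℂ) this.symm

lemma aux_A {G : Type} [Group G] [Fintype G] (V : FDRep ℂ G) [CategoryTheory.Simple V] (h k : G) :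
    V.character 1 * ∑ g, V.character (g * h * g⁻¹ * k) =
      Nat.card G * (V.character h * V.character k) := by
  have key := aux_schur V (∑ g, V.ρ (g * h * g⁻¹)) (by
    intro x
    rw [← Module.End.mul_eq_comp, ← Module.End.mul_eq_comp, Finset.mul_sum, Finset.sum_mul]
    refine Fintype.sum_equiv (Equiv.mulLeft x) _ _ fun g => ?_
    rw [← map_mul, ← map_mul]
    congr 1
    simp [mul_assoc])
  have key2 := congrArg (fun f => LinearMap.trace ℂ V (f * V.ρ k)) key
  simp only [smul_mul_assoc, map_smul, Finset.sum_mul, ← map_mul, map_sum] at key2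
  have e : (LinearMap.id : V →ₗ[ℂ] V) * V.ρ k = V.ρ k := LinearMap.id_comp _
  rw [e] at key2
  change V.character 1 * ∑ g, V.character (g * h * g⁻¹ * k) =
    (∑ g, V.character (g * h * g⁻¹)) * V.character k at key2
  rw [key2]
  simp only [FDRep.char_conj, Finset.sum_const, Finset.card_univ, nsmul_eq_mul,
    Nat.card_eq_fintype_card]
  ring

lemma aux_B {G : Type} [Group G] [Fintype G] (V : FDRep ℂ G) [hV : CategoryTheory.Simple V]
    (k : G) :
    V.character 1 * ∑ h, V.character h * V.character (h⁻¹ * k) =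
      Nat.card G * V.character k := by
  have key := aux_schur V (∑ h, V.character h • V.ρ h⁻¹) (by
    intro x
    rw [← Module.End.mul_eq_comp, ← Module.End.mul_eq_comp, Finset.mul_sum, Finset.sum_mul]
    refine Fintype.sum_equiv (MulAut.conj x).toEquiv _ _ fun g => ?_
    rw [mul_smul_comm, smul_mul_assoc, ← map_mul, ← map_mul]
    simp [mul_assoc]
    rw [← mul_assoc, FDRep.char_conj])
  have key2 := congrArg (fun f => LinearMap.trace ℂ V (f * V.ρ k)) key
  simp only [smul_mul_assoc, map_smul, Finset.sum_mul, ← map_mul, map_sum] at key2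
  have e : (LinearMap.id : V →ₗ[ℂ] V) * V.ρ k = V.ρ k := LinearMap.id_comp _
  rw [e] at key2
  change V.character 1 * ∑ h, V.character h * V.character (h⁻¹ * k) =
    (∑ h, V.character h * V.character h⁻¹) * V.character k at key2
  rw [key2, (FDRep.simple_iff_char_is_norm_one V).mp hV]

lemma aux_span {G : Type} [Group G] [Fintype G] (n : ℕ) :
    ∀ (V : Type) [AddCommGroup V] [Module ℂ V] [FiniteDimensional ℂ V]
      (ρ : Representation ℂ G V), Module.finrank ℂ V = n →
      ρ.character ∈ Submodule.span ℂ {χ | IsIrredChar G χ} := by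
  induction n using Nat.strong_induction_on with
  | _ n ih =>
  intro V _ _ _ ρ hn
  by_cases hs : Subsingleton V
  · have : ρ.character = 0 := by
      ext g
      unfold Representation.character
      rw [Subsingleton.elim (ρ g) 0, map_zero, Pi.zero_apply]
    rw [this]
    exact Submodule.zero_mem _
  by_cases hi : ρ.IsIrreducible
  · apply Submodule.subset_span
    refine ⟨FDRep.of ρ, ?_, fun x => rfl⟩
    rw [FDRep.simple_iff_char_is_norm_one]
    have := invertibleOfNonzero (NeZero.ne (Nat.card G : ℂ))
    have h := Representation.char_orthonormal ρ ρ
    rw [if_pos ⟨Representation.Equiv.refl ρ⟩, inv_mul_eq_one₀ (NeZero.ne _)] at h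
    exact h.symm
  · have hnt : Nontrivial (Subrepresentation ρ) := by
      refine ⟨⊥, ⊤, fun h => hs ?_⟩
      have h2 : (⊥ : Submodule ℂ V) = ⊤ := congrArg Subrepresentation.toSubmodule h
      exact (Submodule.subsingleton_iff ℂ).mp (subsingleton_of_bot_eq_top h2)
    obtain ⟨W, hW1, hW2⟩ : ∃ W : Subrepresentation ρ, W ≠ ⊥ ∧ W ≠ ⊤ := by
      by_contra hcon
      push Not at hcon
      exact hi ⟨fun a => or_iff_not_imp_left.mpr (hcon a)⟩
    obtain ⟨W', hc⟩ := exists_isCompl W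
    have hW1' : W.toSubmodule ≠ ⊥ := fun h => hW1 (Subrepresentation.toSubmodule_injective h)
    have hW2' : W.toSubmodule ≠ ⊤ := fun h => hW2 (Subrepresentation.toSubmodule_injective h)
    have hcs : IsCompl W.toSubmodule W'.toSubmodule := by
      constructor
      · rw [disjoint_iff]
        exact congrArg Subrepresentation.toSubmodule hc.inf_eq_bot
      · rw [codisjoint_iff]
        exact congrArg Subrepresentation.toSubmodule hc.sup_eq_top
    have hadd := Submodule.finrank_add_eq_of_isCompl hcs
    have hlt := Submodule.finrank_lt hW2'
    have hpos : 0 < Module.finrank ℂ W.toSubmodule :=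
      Nat.pos_of_ne_zero fun h => hW1' (Submodule.finrank_eq_zero.mp h)
    have e : ρ.character = W.toRepresentation.character + W'.toRepresentation.character := by
      ext g
      have hint : DirectSum.IsInternal
          (fun b : Bool => bif b then W.toSubmodule else W'.toSubmodule) := by
        rw [DirectSum.isInternal_submodule_iff_isCompl _ (i := true) (j := false) (by simp)
          (by ext b; cases b <;> simp)]
        exact hcs
      have hm : ∀ b : Bool, Set.MapsTo (ρ g)
          ((bif b then W.toSubmodule else W'.toSubmodule : Submodule ℂ V) : Set V)
          ((bif b then W.toSubmodule else W'.toSubmodule : Submodule ℂ V) : Set V) := by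
        intro b
        cases b
        · exact W'.apply_mem_toSubmodule g
        · exact W.apply_mem_toSubmodule g
      have ht := LinearMap.trace_eq_sum_trace_restrict hint hm
      rw [Fintype.sum_bool] at ht
      exact ht
    rw [e]
    exact Submodule.add_mem _ (ih _ (by omega) _ _ rfl) (ih _ (by omega) _ _ rfl)

/-- The right regular representation on functions. -/
def auxReg (G : Type) [Group G] : Representation ℂ G (G → ℂ) where
  toFun g := LinearMap.funLeft ℂ ℂ (fun x => x * g)
  map_one' := by ext; simp [LinearMap.funLeft]
  map_mul' x y := by ext; simp [LinearMap.funLeft, mul_assoc]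

lemma auxReg_char (G : Type) [Group G] [Fintype G] [DecidableEq G] (g : G) :
    (auxReg G).character g = if g = 1 then (Nat.card G : ℂ) else 0 := by
  unfold Representation.character
  rw [LinearMap.trace_eq_matrix_trace ℂ (Pi.basisFun ℂ G), Matrix.trace]
  have : ∀ x : G, (LinearMap.toMatrix (Pi.basisFun ℂ G) (Pi.basisFun ℂ G) (auxReg G g)).diag x =
      if g = 1 then 1 else 0 := by
    intro x
    simp [LinearMap.toMatrix_apply, auxReg, LinearMap.funLeft, Pi.single_apply]
  simp only [this]
  split_ifs <;> simp

lemma aux_reg (G : Type) [Group G] [Fintype G] [DecidableEq G]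
    (S : Finset (G → ℂ)) (hS : ∀ χ : G → ℂ, χ ∈ S ↔ IsIrredChar G χ) (g : G) :
    ∑ χ ∈ S, χ 1 * χ g = if g = 1 then (Nat.card G : ℂ) else 0 := by
  have hcard : (Nat.card G : ℂ) ≠ 0 := NeZero.ne _
  have hinv := invertibleOfNonzero hcard
  have hmem := aux_span _ (G → ℂ) (auxReg G) rfl
  have hset : {χ | IsIrredChar G χ} = (S : Set (G → ℂ)) := by ext χ; simp [hS]
  rw [hset, Submodule.mem_span_finset] at hmem
  obtain ⟨c, -, hc⟩ := hmem
  have orth : ∀ χ ∈ S, ∀ ψ ∈ S, ∑ x, χ x * ψ x⁻¹ = if χ = ψ then (Nat.card G : ℂ) else 0 := by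
    intro χ hχ ψ hψ
    obtain ⟨V, hV, hVχ⟩ := (hS χ).mp hχ
    obtain ⟨W, hW, hWψ⟩ := (hS ψ).mp hψ
    obtain rfl : V.character = χ := funext hVχ
    obtain rfl : W.character = ψ := funext hWψ
    split_ifs with h
    · rw [← h]
      exact (FDRep.simple_iff_char_is_norm_one V).mp hV
    · have := FDRep.char_orthonormal V W
      rw [if_neg (fun ⟨i⟩ => h (FDRep.char_iso i))] at this
      exact (mul_eq_zero.mp this).resolve_left (inv_ne_zero hcard)
  have hcoef : ∀ ψ ∈ S, c ψ = ψ 1 := by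
    intro ψ hψ
    have h1 : ∑ x, (auxReg G).character x * ψ x⁻¹ = Nat.card G * ψ 1 := by
      simp [auxReg_char]
    rw [← hc] at h1
    simp only [Finset.sum_apply, Pi.smul_apply, smul_eq_mul, Finset.sum_mul] at h1
    rw [Finset.sum_comm] at h1
    simp only [mul_assoc, ← Finset.mul_sum] at h1
    rw [Finset.sum_congr rfl (fun χ hχ => by rw [orth χ hχ ψ hψ])] at h1
    simp only [mul_ite, mul_zero, Finset.sum_ite_eq', if_pos hψ] at h1
    rw [mul_comm] at h1
    exact mul_left_cancel₀ hcard h1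
  rw [← auxReg_char, ← hc]
  simp only [Finset.sum_apply, Pi.smul_apply, smul_eq_mul]
  exact Finset.sum_congr rfl fun χ hχ => by rw [hcoef χ hχ]

/-- Frobenius (1896): for a finite group `G` and `z ∈ G`, the number of pairs `(g,h)` with
`[g,h] = z` equals `|G| · Σ_{ψ ∈ Irr(G)} ψ(z)/ψ(1)`. Here `S` is the (finite) set of
irreducible characters of `G`. -/
theorem stmt1 (G : Type) [Group G] [Fintype G]
    (S : Finset (G → ℂ)) (hS : ∀ χ : G → ℂ, χ ∈ S ↔ IsIrredChar G χ) (z : G) :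
    (Nat.card {p : G × G // p.1 * p.2 * p.1⁻¹ * p.2⁻¹ = z} : ℂ) =
      (Nat.card G : ℂ) * ∑ χ ∈ S, χ z / χ 1 := by
  classical
  have hcard : (Nat.card G : ℂ) ≠ 0 := NeZero.ne _
  have hiff : ∀ h g : G, h * g * h⁻¹ * g⁻¹ = z ↔ g * h * g⁻¹ * (h⁻¹ * z) = 1 := by
    intro h g
    constructor
    · rintro rfl
      group
    · intro e
      have : g * h * g⁻¹ * h⁻¹ * z = 1 := by rw [← e]; group
      rw [eq_comm, ← mul_eq_one_iff_inv_eq.mp this]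
      group
  have hN : (Nat.card G : ℂ) * (Nat.card {p : G × G // p.1 * p.2 * p.1⁻¹ * p.2⁻¹ = z} : ℂ) =
      ∑ h : G, ∑ g : G, if g * h * g⁻¹ * (h⁻¹ * z) = 1 then (Nat.card G : ℂ) else 0 := by
    rw [Nat.card_eq_fintype_card (α := {p : G × G // _}), Fintype.card_subtype, Finset.card_filter, Nat.cast_sum,
      Finset.mul_sum, Fintype.sum_prod_type]
    refine Finset.sum_congr rfl fun h _ => Finset.sum_congr rfl fun g _ => ?_
    simp [hiff]
  apply mul_left_cancel₀ hcard
  rw [hN]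
  simp only [← aux_reg G S hS]
  have swap : ∑ h : G, ∑ g : G, ∑ χ ∈ S, χ 1 * χ (g * h * g⁻¹ * (h⁻¹ * z)) =
      ∑ χ ∈ S, ∑ h : G, ∑ g : G, χ 1 * χ (g * h * g⁻¹ * (h⁻¹ * z)) := by
    rw [Finset.sum_comm]
    simp only [Finset.sum_comm (s := Finset.univ) (t := S)]
    refine Finset.sum_congr rfl fun χ _ => Finset.sum_comm
  rw [swap, Finset.mul_sum, Finset.mul_sum]
  refine Finset.sum_congr rfl fun χ hχ => ?_
  obtain ⟨V, hV, hVχ⟩ := (hS χ).mp hχ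
  obtain rfl : V.character = χ := funext hVχ
  have hne := aux_char_one_ne V
  simp only [← Finset.mul_sum (s := Finset.univ)]
  simp only [Finset.mul_sum (f := fun h => ∑ g, V.character (g * h * g⁻¹ * (h⁻¹ * z))), aux_A]
  simp only [← Finset.mul_sum]
  have hB := aux_B V z
  field_simp
  linear_combination hB
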